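/- arXiv:2106.02955 — 2 statements merged into one kernel-verified Lean document; each statement's English description precedes it below -/
import Mathlib

section
/- Let J be a sparse symmetric shifted ideal in Z and suppose f = ∏_{i : λ_i>0} z_{σ(i),λ_i} ∈ J, where λ(f) = (λ_1 ≤ … ≤ λ_s) is the associated partition of f and σ ∈ S_s. If indices i_1, i_2 satisfy λ_{i_1} = 0 and 0 < k ≤ λ_{i_2} for some integer k, then the monomial f' = f · z_{σ(i_1),k} / z_{σ(i_2),λ_{i_2}} belongs to J. -/
open MvPolynomial

/-- The sparse squarefree monomial `z^μ = ∏_{i : μ i > 0} z_{i, μ i}`, where the variable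
`z_{i,j}` (for `1 ≤ j ≤ b`) is represented by `X (i, j-1)`. -/
noncomputable def sparseMon (K : Type*) [Field K] (s b : ℕ) (μ : Fin s → ℕ) :
    MvPolynomial (Fin s × Fin b) K :=
  ∏ i : Fin s, ∏ j : Fin b, if μ i = (j : ℕ) + 1 then X (i, j) else 1

/-- `μ' ≤₀ μ`. -/
def leZero {s : ℕ} (μ' μ : Fin s → ℕ) : Prop :=
  ∀ i, μ' i ≤ μ i ∧ (μ' i = 0 ↔ μ i = 0)

/-- The action of `σ ∈ S_s` on `Z`, sending `z_{i,j}` to `z_{σ i, j}`. -/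
noncomputable def permMap (K : Type*) [Field K] (s b : ℕ) (σ : Equiv.Perm (Fin s)) :
    MvPolynomial (Fin s × Fin b) K →ₐ[K] MvPolynomial (Fin s × Fin b) K :=
  rename fun p => (σ p.1, p.2)

/-- `z^μ` is a minimal monomial generator of the monomial ideal `J`. -/
def IsMinSparseGen (K : Type*) [Field K] (s b : ℕ)
    (J : Ideal (MvPolynomial (Fin s × Fin b) K)) (μ : Fin s → ℕ) : Prop :=
  (∀ i, μ i ≤ b) ∧ sparseMon K s b μ ∈ J ∧
    ∀ i, 0 < μ i → sparseMon K s b (Function.update μ i 0) ∉ J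

/-- A proper monomial ideal `J` of `Z` is sparse symmetric shifted if (S-1) it is generated
by sparse squarefree monomials, (S-2) for every minimal monomial generator `z^μ` and every
`μ' ≤₀ μ` one has `z^{μ'} ∈ J`, and (S-3) `σ(J) = J` for every permutation `σ`. -/
def IsSSS (K : Type*) [Field K] (s b : ℕ)
    (J : Ideal (MvPolynomial (Fin s × Fin b) K)) : Prop :=
  J ≠ ⊤ ∧
  (∃ S : Set (Fin s → ℕ), (∀ μ ∈ S, ∀ i, μ i ≤ b) ∧
      J = Ideal.span (sparseMon K s b '' S)) ∧
  (∀ μ : Fin s → ℕ, IsMinSparseGen K s b J μ →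
      ∀ μ' : Fin s → ℕ, leZero μ' μ → sparseMon K s b μ' ∈ J) ∧
  (∀ σ : Equiv.Perm (Fin s), Ideal.map (permMap K s b σ) J = J)

theorem permMap_sparseMon {K : Type*} [Field K] {s b : ℕ} (σ : Equiv.Perm (Fin s))
    (μ : Fin s → ℕ) :
    permMap K s b σ (sparseMon K s b μ) = sparseMon K s b (μ ∘ σ.symm) := by
  unfold permMap sparseMon
  rw [map_prod]
  refine Fintype.prod_equiv σ _ _ fun i => ?_
  rw [map_prod]
  refine Finset.prod_congr rfl fun j _ => ?_
  simp only [Function.comp_apply, Equiv.symm_apply_apply]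
  split_ifs <;> simp

theorem sparseMon_update_zero_dvd (K : Type*) [Field K] {s : ℕ} (b : ℕ) (μ : Fin s → ℕ)
    (i : Fin s) : sparseMon K s b (Function.update μ i 0) ∣ sparseMon K s b μ := by
  refine Finset.prod_dvd_prod_of_dvd _ _ fun l _ => ?_
  obtain rfl | hl := eq_or_ne l i
  · simp
  · rw [Function.update_of_ne hl]

theorem leZero.update_zero {s : ℕ} {μ' μ : Fin s → ℕ} (h : leZero μ' μ) (i : Fin s) :
    leZero (Function.update μ' i 0) (Function.update μ i 0) := by
  intro l
  obtain rfl | hl := eq_or_ne l i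
  · simp
  · simpa only [Function.update_of_ne hl] using h l

theorem IsSSS.permMap_mem {K : Type*} [Field K] {s b : ℕ}
    {J : Ideal (MvPolynomial (Fin s × Fin b) K)} (hJ : IsSSS K s b J)
    (σ : Equiv.Perm (Fin s)) {p : MvPolynomial (Fin s × Fin b) K} (hp : p ∈ J) :
    permMap K s b σ p ∈ J :=
  (hJ.2.2.2 σ).le (Ideal.mem_map_of_mem _ hp)

/-- The shifting condition extends from minimal generators to all sparse monomials. -/
theorem IsSSS.sparseMon_mem_of_leZero {K : Type*} [Field K] {s b : ℕ}
    {J : Ideal (MvPolynomial (Fin s × Fin b) K)} (hJ : IsSSS K s b J)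
    {μ μ' : Fin s → ℕ} (hb : ∀ i, μ i ≤ b) (hμ : sparseMon K s b μ ∈ J) (h : leZero μ' μ) :
    sparseMon K s b μ' ∈ J := by
  induction hn : ∑ i, μ i using Nat.strong_induction_on generalizing μ μ' with
  | _ n ih =>
    by_cases hmin : IsMinSparseGen K s b J μ
    · exact hJ.2.2.1 μ hmin μ' h
    obtain ⟨i, hi, hmem⟩ : ∃ i, 0 < μ i ∧ sparseMon K s b (Function.update μ i 0) ∈ J := by
      by_contra! hcon
      exact hmin ⟨hb, hμ, hcon⟩
    have hle : Function.update μ i 0 ≤ μ := by simp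
    have hlt : ∑ l, Function.update μ i 0 l < n :=
      hn ▸ Finset.sum_lt_sum (fun l _ => hle l) ⟨i, Finset.mem_univ i, by simpa using hi⟩
    exact J.mem_of_dvd (sparseMon_update_zero_dvd K b μ' i)
      (ih _ hlt (fun l => (hle l).trans (hb l)) hmem (h.update_zero i) rfl)

/-- If `J` is sparse symmetric shifted, `f = ∏_{i : λ i > 0} z_{σ i, λ i} ∈ J`
with `λ` the associated (nondecreasing) partition, `λ i₁ = 0` and `0 < k ≤ λ i₂`, then
`f' = f · z_{σ i₁, k} / z_{σ i₂, λ i₂}` (the sparse monomial of the tuple obtained from `λ` by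
replacing the `i₁`-entry by `k` and the `i₂`-entry by `0`) belongs to `J`. -/
theorem sss_swap_mem {K : Type*} [Field K] (s b : ℕ)
    (J : Ideal (MvPolynomial (Fin s × Fin b) K)) (hJ : IsSSS K s b J)
    (lam : Fin s → ℕ) (hmono : Monotone lam) (hb : ∀ i, lam i ≤ b)
    (σ : Equiv.Perm (Fin s))
    (hf : permMap K s b σ (sparseMon K s b lam) ∈ J)
    (i₁ i₂ : Fin s) (k : ℕ) (h₁ : lam i₁ = 0) (hk : 0 < k) (h₂ : k ≤ lam i₂) :
    permMap K s b σ (sparseMon K s b (Function.update (Function.update lam i₁ k) i₂ 0)) ∈ J := by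
  refine hJ.permMap_mem σ ?_
  have hlam : sparseMon K s b lam ∈ J := by
    have := hJ.permMap_mem σ.symm hf
    rw [permMap_sparseMon, permMap_sparseMon] at this
    simpa [Function.comp_assoc] using this
  have hswap := hJ.permMap_mem (Equiv.swap i₁ i₂) hlam
  rw [permMap_sparseMon, Equiv.symm_swap] at hswap
  refine hJ.sparseMon_mem_of_leZero (fun i => hb _) hswap fun i => ?_
  have hne : i₁ ≠ i₂ := by
    rintro rfl
    omega
  obtain rfl | hi₂ := eq_or_ne i i₂
  · simp [h₁]
  obtain rfl | hi₁ := eq_or_ne i i₁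
  · simp only [Function.update_of_ne hne, Function.update_self, Equiv.swap_apply_left]
    omega
  · simp [Function.update_of_ne hi₂, Function.update_of_ne hi₁,
      Equiv.swap_apply_of_ne_of_ne hi₁ hi₂]
end

section
/- If an ideal J of Z is generated by sparse squarefree monomials and f is any monomial in Z, then the colon ideal (J : f) is generated by sparse squarefree monomials, each of which is coprime to f. -/
open MvPolynomial

/-- The exponent vector of the sparse squarefree monomial `z^μ`. -/
noncomputable def sparseExponent (s b : ℕ) (μ : Fin s → ℕ) : (Fin s × Fin b) →₀ ℕ :=
  ∑ p : Fin s × Fin b, if μ p.1 = (p.2 : ℕ) + 1 then Finsupp.single p 1 else 0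

theorem sparseExponent_apply (s b : ℕ) (μ : Fin s → ℕ) (p : Fin s × Fin b) :
    sparseExponent s b μ p = if μ p.1 = (p.2 : ℕ) + 1 then 1 else 0 := by
  classical
  rw [sparseExponent, Finsupp.finsetSum_apply, Finset.sum_eq_single p]
  · split_ifs <;> simp
  · intro q _ hq
    split_ifs <;> simp [hq]
  · simp

theorem sparseMon_eq_monomial (K : Type*) [Field K] (s b : ℕ) (μ : Fin s → ℕ) :
    sparseMon K s b μ = monomial (sparseExponent s b μ) 1 := by
  rw [sparseMon, ← Fintype.prod_prod_type', sparseExponent, monomial_sum_one]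
  refine Finset.prod_congr rfl fun p _ => ?_
  split_ifs <;> rfl

/-- The colon of a monomial ideal by a monomial is generated by the truncated differences of the
exponents. -/
theorem colon_span_monomial_image {σ R : Type*} [CommRing R] (T : Set (σ →₀ ℕ)) (ν : σ →₀ ℕ) :
    Submodule.colon (Ideal.span ((fun m => monomial m (1 : R)) '' T))
        (Ideal.span {(monomial ν 1 : MvPolynomial σ R)}) =
      Ideal.span ((fun m => monomial m (1 : R)) '' ((· - ν) '' T)) := by
  ext x
  rw [Ideal.mem_colon_span_singleton, mem_ideal_span_monomial_image,
    mem_ideal_span_monomial_image]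
  simp only [Set.exists_mem_image, tsub_le_iff_right]
  constructor
  · intro h m hm
    refine h (m + ν) ?_
    rw [mem_support_iff, coeff_mul_monomial, mul_one]
    exact mem_support_iff.mp hm
  · intro h m hm
    rw [mem_support_iff, coeff_mul_monomial', mul_one] at hm
    split_ifs at hm with hle
    · simpa [tsub_add_cancel_of_le hle] using h (m - ν) (mem_support_iff.mpr hm)
    · exact absurd rfl hm

open Classical in
/-- The index tuple obtained from `μ` by erasing the entries whose variable divides the monomial
with exponent `ν`. -/
noncomputable def eraseDividing {s b : ℕ} (ν : (Fin s × Fin b) →₀ ℕ) (μ : Fin s → ℕ) :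
    Fin s → ℕ :=
  fun i => if ∃ j : Fin b, μ i = (j : ℕ) + 1 ∧ ν (i, j) ≠ 0 then 0 else μ i

theorem eraseDividing_le {s b : ℕ} (ν : (Fin s × Fin b) →₀ ℕ) (μ : Fin s → ℕ) (i : Fin s) :
    eraseDividing ν μ i ≤ μ i := by
  unfold eraseDividing
  split_ifs <;> simp

theorem eraseDividing_eq_succ_iff {s b : ℕ} (ν : (Fin s × Fin b) →₀ ℕ) (μ : Fin s → ℕ)
    (i : Fin s) (j : Fin b) :
    eraseDividing ν μ i = (j : ℕ) + 1 ↔ μ i = (j : ℕ) + 1 ∧ ν (i, j) = 0 := by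
  unfold eraseDividing
  split_ifs with h
  · obtain ⟨k, hk, hν⟩ := h
    refine ⟨False.elim, fun ⟨hj, h0⟩ => ?_⟩
    obtain rfl : k = j := Fin.ext (Nat.succ.inj (hk.symm.trans hj))
    exact absurd h0 hν
  · push Not at h
    exact ⟨fun hj => ⟨hj, h j hj⟩, And.left⟩

theorem sparseExponent_eraseDividing {s b : ℕ} (ν : (Fin s × Fin b) →₀ ℕ) (μ : Fin s → ℕ) :
    sparseExponent s b (eraseDividing ν μ) = sparseExponent s b μ - ν := by
  ext ⟨i, j⟩
  simp only [Finsupp.tsub_apply, sparseExponent_apply, eraseDividing_eq_succ_iff]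
  split_ifs <;> grind

theorem isRelPrime_sparseMon_eraseDividing (K : Type*) [Field K] {s b : ℕ}
    (ν : (Fin s × Fin b) →₀ ℕ) (μ : Fin s → ℕ) :
    IsRelPrime (sparseMon K s b (eraseDividing ν μ))
      (monomial ν 1 : MvPolynomial (Fin s × Fin b) K) := by
  refine IsRelPrime.prod_left fun i _ => IsRelPrime.prod_left fun j _ => ?_
  split_ifs with h
  · rw [(X_prime (R := K)).irreducible.isRelPrime_iff_not_dvd, X_dvd_monomial]
    simp [((eraseDividing_eq_succ_iff ν μ i j).mp h).2]
  · exact isRelPrime_one_left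

/-- If an ideal `J` of `Z` is generated by sparse squarefree monomials and
`f` is a monomial of `Z`, then the colon ideal `(J : f)` is generated by sparse squarefree
monomials, each of which is coprime to `f`. -/
theorem colon_of_sparse_gen {K : Type*} [Field K] (s b : ℕ)
    (S : Set (Fin s → ℕ)) (hS : ∀ μ ∈ S, ∀ i, μ i ≤ b)
    (J : Ideal (MvPolynomial (Fin s × Fin b) K))
    (hJ : J = Ideal.span (sparseMon K s b '' S))
    (ν : (Fin s × Fin b) →₀ ℕ) :
    ∃ S' : Set (Fin s → ℕ),
      (∀ μ ∈ S', (∀ i, μ i ≤ b) ∧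
        IsRelPrime (sparseMon K s b μ) ((monomial ν 1 : MvPolynomial (Fin s × Fin b) K))) ∧
      Submodule.colon J (Ideal.span {(monomial ν 1 : MvPolynomial (Fin s × Fin b) K)}) =
        Ideal.span (sparseMon K s b '' S') := by
  refine ⟨eraseDividing ν '' S, ?_, ?_⟩
  · rintro _ ⟨μ, hμ, rfl⟩
    exact ⟨fun i => (eraseDividing_le ν μ i).trans (hS μ hμ i),
      isRelPrime_sparseMon_eraseDividing K ν μ⟩
  · have himage (U : Set (Fin s → ℕ)) : sparseMon K s b '' U =
        (fun m => monomial m (1 : K)) '' (sparseExponent s b '' U) := by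
      simp only [Set.image_image, ← sparseMon_eq_monomial]
    rw [hJ, himage, himage, colon_span_monomial_image]
    simp only [Set.image_image, sparseExponent_eraseDividing]
end
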